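/- arXiv:2301.10039 — 10 statements merged into one kernel-verified Lean document; each statement's English description precedes it below -/
import Mathlib

section
/- Let C be a monoidal category, let D : C → Cᵒᵖ be an equivalence of categories (regarded as a contravariant endofunctor of C), let k be an object of C, and suppose given bijections Hom_C(x ⊗ y, k) ≅ Hom_C(x, D(y)), natural in x and y. Then there exist bijections Hom_C(x ⊗ y, D(z)) ≅ Hom_C(x, D(y ⊗ z)), natural in x, y and z. (Implication (3) ⇒ (2) in the equivalence of definitions of a ★-autonomous category.) -/
open CategoryTheory MonoidalCategory Opposite

/-- Implication (3) ⇒ (2) in the equivalence of definitions of a ★-autonomous category: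
given a monoidal category `C`, an equivalence `D : C ⥤ Cᵒᵖ` (viewed as a contravariant
endofunctor of `C`), an object `k`, and bijections `Hom(x ⊗ y, k) ≅ Hom(x, D y)`
natural in `x` and `y`, there are bijections `Hom(x ⊗ y, D z) ≅ Hom(x, D (y ⊗ z))`
natural in `x, y, z`. -/
theorem statement_1 {C : Type*} [Category C] [MonoidalCategory C]
    (D : C ⥤ Cᵒᵖ) [D.IsEquivalence] (k : C)
    (e : ∀ x y : C, (x ⊗ y ⟶ k) ≃ (x ⟶ (D.obj y).unop))
    (he₁ : ∀ {x x' : C} (f : x' ⟶ x) (y : C) (g : x ⊗ y ⟶ k),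
      e x' y ((f ▷ y) ≫ g) = f ≫ e x y g)
    (he₂ : ∀ (x : C) {y y' : C} (f : y' ⟶ y) (g : x ⊗ y ⟶ k),
      e x y' ((x ◁ f) ≫ g) = e x y g ≫ (D.map f).unop) :
    ∃ e' : ∀ x y z : C, (x ⊗ y ⟶ (D.obj z).unop) ≃ (x ⟶ (D.obj (y ⊗ z)).unop),
      (∀ {x x' : C} (f : x' ⟶ x) (y z : C) (g : x ⊗ y ⟶ (D.obj z).unop),
        e' x' y z ((f ▷ y) ≫ g) = f ≫ e' x y z g) ∧
      (∀ (x : C) {y y' : C} (f : y' ⟶ y) (z : C) (g : x ⊗ y ⟶ (D.obj z).unop),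
        e' x y' z ((x ◁ f) ≫ g) = e' x y z g ≫ (D.map (f ▷ z)).unop) ∧
      (∀ (x y : C) {z z' : C} (f : z' ⟶ z) (g : x ⊗ y ⟶ (D.obj z).unop),
        e' x y z' (g ≫ (D.map f).unop) = e' x y z g ≫ (D.map (y ◁ f)).unop) := by
  have hs₁ : ∀ {x x' : C} (f : x' ⟶ x) (y : C) (g : x ⟶ (D.obj y).unop),
      (e x' y).symm (f ≫ g) = f ▷ y ≫ (e x y).symm g := fun f y g => by
    rw [Equiv.symm_apply_eq, he₁, Equiv.apply_symm_apply]
  have hs₂ : ∀ (x : C) {y y' : C} (f : y' ⟶ y) (g : x ⟶ (D.obj y).unop),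
      (e x y').symm (g ≫ (D.map f).unop) = x ◁ f ≫ (e x y).symm g := fun x _ _ f g => by
    rw [Equiv.symm_apply_eq, he₂, Equiv.apply_symm_apply]
  refine ⟨fun x y z => ((e (x ⊗ y) z).symm.trans (α_ x y z).homFromEquiv).trans (e x (y ⊗ z)),
    fun f y z g => ?_, fun x _ _ f z g => ?_, fun x y _ _ f g => ?_⟩
  · simp [hs₁, ← he₁]
  · simp [hs₁, ← he₂]
  · simp [hs₂, ← he₂]
end

section
/- Let C be a monoidal category, let (D, D⁻¹) be an adjoint equivalence between C and Cᵒᵖ (so D and D⁻¹ are mutually quasi-inverse contravariant endofunctors of C), and let k be an object of C. Then there exists a family of bijections Hom_C(x ⊗ y, k) ≅ Hom_C(x, D(y)), natural in x and y, if and only if there exists a family of bijections Hom_C(x ⊗ y, k) ≅ Hom_C(y, D⁻¹(x)), natural in x and y. (Equivalence (3) ⇔ (4) in the equivalence of definitions of a ★-autonomous (Grothendieck–Verdier) category.) -/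
open CategoryTheory MonoidalCategory Opposite

/-- The adjunction bijection `Hom(x, D y) ≃ Hom(y, D⁻¹ x)` of an equivalence `C ≌ Cᵒᵖ`. -/
def CategoryTheory.Equivalence.dualityHomEquiv {C : Type*} [Category C] (E : C ≌ Cᵒᵖ) (x y : C) :
    (x ⟶ (E.functor.obj y).unop) ≃ (y ⟶ E.inverse.obj (Opposite.op x)) :=
  (opEquiv (E.functor.obj y) (Opposite.op x)).symm.trans (E.toAdjunction.homEquiv y (Opposite.op x))

theorem CategoryTheory.Equivalence.dualityHomEquiv_comp {C : Type*} [Category C] (E : C ≌ Cᵒᵖ)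
    {x x' : C} (f : x' ⟶ x) (y : C) (g : x ⟶ (E.functor.obj y).unop) :
    E.dualityHomEquiv x' y (f ≫ g) = E.dualityHomEquiv x y g ≫ E.inverse.map f.op :=
  E.toAdjunction.homEquiv_naturality_right g.op f.op

theorem CategoryTheory.Equivalence.dualityHomEquiv_comp_map {C : Type*} [Category C]
    (E : C ≌ Cᵒᵖ) (x : C) {y y' : C} (f : y' ⟶ y) (g : x ⟶ (E.functor.obj y).unop) :
    E.dualityHomEquiv x y' (g ≫ (E.functor.map f).unop) = f ≫ E.dualityHomEquiv x y g :=
  E.toAdjunction.homEquiv_naturality_left f g.op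

/-- Equivalence (3) ⇔ (4) in the equivalence of definitions of a ★-autonomous
(Grothendieck–Verdier) category: for a monoidal category `C`, an adjoint equivalence
`E : C ≌ Cᵒᵖ` (with `D := E.functor` and `D⁻¹ := E.inverse` viewed as mutually
quasi-inverse contravariant endofunctors of `C`), and an object `k`, there is a family
of bijections `Hom(x ⊗ y, k) ≅ Hom(x, D y)`, natural in `x` and `y`, iff there is a
family of bijections `Hom(x ⊗ y, k) ≅ Hom(y, D⁻¹ x)`, natural in `x` and `y`. -/
theorem statement_2 {C : Type*} [Category C] [MonoidalCategory C]
    (E : C ≌ Cᵒᵖ) (k : C) :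
    (∃ e : ∀ x y : C, (x ⊗ y ⟶ k) ≃ (x ⟶ (E.functor.obj y).unop),
      (∀ {x x' : C} (f : x' ⟶ x) (y : C) (g : x ⊗ y ⟶ k),
        e x' y ((f ▷ y) ≫ g) = f ≫ e x y g) ∧
      (∀ (x : C) {y y' : C} (f : y' ⟶ y) (g : x ⊗ y ⟶ k),
        e x y' ((x ◁ f) ≫ g) = e x y g ≫ (E.functor.map f).unop)) ↔
    (∃ e' : ∀ x y : C, (x ⊗ y ⟶ k) ≃ (y ⟶ E.inverse.obj (op x)),
      (∀ {x x' : C} (f : x' ⟶ x) (y : C) (g : x ⊗ y ⟶ k),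
        e' x' y ((f ▷ y) ≫ g) = e' x y g ≫ E.inverse.map f.op) ∧
      (∀ (x : C) {y y' : C} (f : y' ⟶ y) (g : x ⊗ y ⟶ k),
        e' x y' ((x ◁ f) ≫ g) = f ≫ e' x y g)) := by
  constructor
  · rintro ⟨e, h₁, h₂⟩
    refine ⟨fun x y => (e x y).trans (E.dualityHomEquiv x y), fun f y g => ?_, fun x _ _ f g => ?_⟩
    · simp only [Equiv.trans_apply, h₁, E.dualityHomEquiv_comp]
    · simp only [Equiv.trans_apply, h₂, E.dualityHomEquiv_comp_map]
  · rintro ⟨e, h₁, h₂⟩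
    refine ⟨fun x y => (e x y).trans (E.dualityHomEquiv x y).symm, fun f y g => ?_,
      fun x _ _ f g => ?_⟩
    · simp only [Equiv.trans_apply, h₁, Equiv.symm_apply_eq, E.dualityHomEquiv_comp,
        Equiv.apply_symm_apply]
    · simp only [Equiv.trans_apply, h₂, Equiv.symm_apply_eq, E.dualityHomEquiv_comp_map,
        Equiv.apply_symm_apply]
end

section
/- Let C be a monoidal category, let (D, D⁻¹) be an adjoint equivalence between C and Cᵒᵖ (regarded as mutually quasi-inverse contravariant endofunctors of C), and suppose given bijections Hom_C(x ⊗ y, D(z)) ≅ Hom_C(x, D(y ⊗ z)), natural in x, y and z. Then C is biclosed with internal homs given explicitly by the duality: there are bijections Hom_C(x ⊗ y, z) ≅ Hom_C(x, D(y ⊗ D⁻¹(z))), natural in x, y and z, and bijections Hom_C(x ⊗ y, z) ≅ Hom_C(y, D⁻¹(D(z) ⊗ x)), natural in x, y and z; equivalently, for every y the functor − ⊗ y has right adjoint z ↦ D(y ⊗ D⁻¹(z)), and for every x the functor x ⊗ − has right adjoint z ↦ D⁻¹(D(z) ⊗ x). (Implication (2) ⇒ (1) in the equivalence of definitions of a ★-autonomous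 category.) -/
open CategoryTheory MonoidalCategory Opposite

/-- Implication (2) ⇒ (1) in the equivalence of definitions of a ★-autonomous category:
given a monoidal category `C`, an adjoint equivalence `E : C ≌ Cᵒᵖ` (with
`D := E.functor`, `D⁻¹ := E.inverse` viewed as mutually quasi-inverse contravariant
endofunctors of `C`) and bijections `Hom(x ⊗ y, D z) ≅ Hom(x, D (y ⊗ z))` natural in
`x, y, z`, the category `C` is biclosed, with internal homs given by the duality:
there are bijections `Hom(x ⊗ y, z) ≅ Hom(x, D(y ⊗ D⁻¹ z))` natural in `x, y, z`, and
bijections `Hom(x ⊗ y, z) ≅ Hom(y, D⁻¹(D z ⊗ x))` natural in `x, y, z`; equivalently,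
`− ⊗ y` has right adjoint `z ↦ D(y ⊗ D⁻¹ z)` and `x ⊗ −` has right adjoint
`z ↦ D⁻¹(D z ⊗ x)`. -/
theorem statement_4 {C : Type*} [Category C] [MonoidalCategory C]
    (E : C ≌ Cᵒᵖ)
    (e : ∀ x y z : C, (x ⊗ y ⟶ (E.functor.obj z).unop) ≃ (x ⟶ (E.functor.obj (y ⊗ z)).unop))
    (he₁ : ∀ {x x' : C} (f : x' ⟶ x) (y z : C) (g : x ⊗ y ⟶ (E.functor.obj z).unop),
      e x' y z ((f ▷ y) ≫ g) = f ≫ e x y z g)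
    (he₂ : ∀ (x : C) {y y' : C} (f : y' ⟶ y) (z : C) (g : x ⊗ y ⟶ (E.functor.obj z).unop),
      e x y' z ((x ◁ f) ≫ g) = e x y z g ≫ (E.functor.map (f ▷ z)).unop)
    (he₃ : ∀ (x y : C) {z z' : C} (f : z' ⟶ z) (g : x ⊗ y ⟶ (E.functor.obj z).unop),
      e x y z' (g ≫ (E.functor.map f).unop) = e x y z g ≫ (E.functor.map (y ◁ f)).unop) :
    (∃ e₁ : ∀ x y z : C,
        (x ⊗ y ⟶ z) ≃ (x ⟶ (E.functor.obj (y ⊗ E.inverse.obj (op z))).unop),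
      (∀ {x x' : C} (f : x' ⟶ x) (y z : C) (g : x ⊗ y ⟶ z),
        e₁ x' y z ((f ▷ y) ≫ g) = f ≫ e₁ x y z g) ∧
      (∀ (x : C) {y y' : C} (f : y' ⟶ y) (z : C) (g : x ⊗ y ⟶ z),
        e₁ x y' z ((x ◁ f) ≫ g) =
          e₁ x y z g ≫ (E.functor.map (f ▷ E.inverse.obj (op z))).unop) ∧
      (∀ (x y : C) {z z' : C} (f : z ⟶ z') (g : x ⊗ y ⟶ z),
        e₁ x y z' (g ≫ f) =
          e₁ x y z g ≫ (E.functor.map (y ◁ E.inverse.map f.op)).unop)) ∧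
    (∃ e₂ : ∀ x y z : C,
        (x ⊗ y ⟶ z) ≃ (y ⟶ E.inverse.obj (op ((E.functor.obj z).unop ⊗ x))),
      (∀ {x x' : C} (f : x' ⟶ x) (y z : C) (g : x ⊗ y ⟶ z),
        e₂ x' y z ((f ▷ y) ≫ g) =
          e₂ x y z g ≫ E.inverse.map ((E.functor.obj z).unop ◁ f).op) ∧
      (∀ (x : C) {y y' : C} (f : y' ⟶ y) (z : C) (g : x ⊗ y ⟶ z),
        e₂ x y' z ((x ◁ f) ≫ g) = f ≫ e₂ x y z g) ∧
      (∀ (x y : C) {z z' : C} (f : z ⟶ z') (g : x ⊗ y ⟶ z),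
        e₂ x y z' (g ≫ f) =
          e₂ x y z g ≫ E.inverse.map ((E.functor.map f).unop ▷ x).op)) ∧
    (∀ y : C, ∃ R : C ⥤ C,
      (∀ z : C, R.obj z = (E.functor.obj (y ⊗ E.inverse.obj (op z))).unop) ∧
      Nonempty (tensorRight y ⊣ R)) ∧
    (∀ x : C, ∃ R : C ⥤ C,
      (∀ z : C, R.obj z = E.inverse.obj (op ((E.functor.obj z).unop ⊗ x))) ∧
      Nonempty (tensorLeft x ⊣ R)) := by
  let e₁ (x y z : C) : (x ⊗ y ⟶ z) ≃ (x ⟶ (E.functor.obj (y ⊗ E.inverse.obj (op z))).unop) :=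
    ((E.counitIso.app (op z)).unop.homToEquiv).trans (e x y (E.inverse.obj (op z)))
  have e₁_apply (x y z : C) (g : x ⊗ y ⟶ z) :
      e₁ x y z g = e x y (E.inverse.obj (op z)) (g ≫ (E.counit.app (op z)).unop) := rfl
  let e₂ (x y z : C) : (x ⊗ y ⟶ z) ≃ (y ⟶ E.inverse.obj (op ((E.functor.obj z).unop ⊗ x))) :=
    (E.fullyFaithfulFunctor.homEquiv.trans (opEquiv _ _)).trans <|
      (e (E.functor.obj z).unop x y).symm.trans <|
        (opEquiv _ (op ((E.functor.obj z).unop ⊗ x))).symm.trans (E.toAdjunction.homEquiv _ _)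
  have e₂_apply (x y z : C) (g : x ⊗ y ⟶ z) :
      e₂ x y z g = E.toAdjunction.homEquiv _ _
        ((e (E.functor.obj z).unop x y).symm (E.functor.map g).unop).op := rfl
  have e₁_nat_left {x x' : C} (f : x' ⟶ x) (y z : C) (g : x ⊗ y ⟶ z) :
      e₁ x' y z ((f ▷ y) ≫ g) = f ≫ e₁ x y z g := by
    rw [e₁_apply, e₁_apply, Category.assoc, he₁]
  have e₁_nat_right (x y : C) {z z' : C} (f : z ⟶ z') (g : x ⊗ y ⟶ z) :
      e₁ x y z' (g ≫ f) =
        e₁ x y z g ≫ (E.functor.map (y ◁ E.inverse.map f.op)).unop := by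
    rw [e₁_apply, e₁_apply, ← he₃, Category.assoc, Category.assoc]
    congr 2
    exact congrArg Quiver.Hom.unop (E.counit.naturality f.op).symm
  have e₂_nat_mid (x : C) {y y' : C} (f : y' ⟶ y) (z : C) (g : x ⊗ y ⟶ z) :
      e₂ x y' z ((x ◁ f) ≫ g) = f ≫ e₂ x y z g := by
    rw [e₂_apply, e₂_apply, ← Adjunction.homEquiv_naturality_left]
    congr 1
    apply Quiver.Hom.unop_inj
    apply (e _ _ _).injective
    simp [he₃]
  have e₂_nat_right (x y : C) {z z' : C} (f : z ⟶ z') (g : x ⊗ y ⟶ z) :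
      e₂ x y z' (g ≫ f) =
        e₂ x y z g ≫ E.inverse.map ((E.functor.map f).unop ▷ x).op := by
    rw [e₂_apply, e₂_apply, ← Adjunction.homEquiv_naturality_right]
    congr 1
    apply Quiver.Hom.unop_inj
    apply (e _ _ _).injective
    simp [he₁]
  refine ⟨⟨e₁, e₁_nat_left, fun x y y' f z g => ?_, e₁_nat_right⟩,
    ⟨e₂, fun {x x'} f y z g => ?_, e₂_nat_mid, e₂_nat_right⟩, fun y => ?_, fun x => ?_⟩
  · rw [e₁_apply, e₁_apply, Category.assoc, he₂]
  · rw [e₂_apply, e₂_apply, ← Adjunction.homEquiv_naturality_right]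
    congr 1
    apply Quiver.Hom.unop_inj
    apply (e _ _ _).injective
    simp [he₂]
  · exact ⟨Adjunction.rightAdjointOfEquiv (F := tensorRight y) (fun x z => e₁ x y z)
      (fun _ _ _ f g => e₁_nat_left f y _ g), fun _ => rfl,
      ⟨Adjunction.adjunctionOfEquivRight _ _⟩⟩
  · exact ⟨Adjunction.rightAdjointOfEquiv (F := tensorLeft x) (fun y z => e₂ x y z)
      (fun _ _ _ f g => e₂_nat_mid x f _ g), fun _ => rfl,
      ⟨Adjunction.adjunctionOfEquivRight _ _⟩⟩
end

section
/- Let C be a biclosed monoidal category: for every y the functor − ⊗ y has a right adjoint H_l(y,−), and for every x the functor x ⊗ − has a right adjoint H_r(x,−). For objects x, k of C, let ev_{x,k} : H_l(x,k) ⊗ x → k be the counit of the first adjunction (the adjunct of the identity of H_l(x,k)), let u_x : x → H_r(H_l(x,k), k) be the adjunct of ev_{x,k} under the adjunction (H_l(x,k) ⊗ −) ⊣ H_r(H_l(x,k), −), and let v_x : x → H_l(H_r(x,k), k) be defined analogously from the counit x ⊗ H_r(x,k) → k of the second adjunction. Suppose k is a dualizing object, i.e. u_x and v_x are isomorphisms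 for every object x. Then x ↦ H_l(x,k) underlies an equivalence of categories D : C → Cᵒᵖ with quasi-inverse x ↦ H_r(x,k), and there are bijections Hom_C(x ⊗ y, H_l(z,k)) ≅ Hom_C(x, H_l(y ⊗ z, k)), natural in x, y and z. (Implication (1) ⇒ (2) in the equivalence of definitions of a ★-autonomous category.) -/
open CategoryTheory MonoidalCategory Opposite

section InternalHomDuality

variable {C : Type*} [Category C] [MonoidalCategory C] {Hl Hr : Cᵒᵖ ⥤ C ⥤ C}

/-- Dinaturality of the evaluation of the left internal hom. -/
lemma whiskerRight_map_comp_counit (adjl : ∀ y : C, tensorRight y ⊣ Hl.obj (op y))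
    (hnatl : ∀ {y y' : C} (f : y' ⟶ y) (x z : C) (g : x ⊗ y ⟶ z),
      ((adjl y').homEquiv x z) ((x ◁ f) ≫ g) =
        ((adjl y).homEquiv x z) g ≫ (Hl.map f.op).app z)
    {x y : C} (f : x ⟶ y) (k : C) :
    ((Hl.map f.op).app k ▷ x) ≫ (adjl x).counit.app k =
      ((Hl.obj (op y)).obj k ◁ f) ≫ (adjl y).counit.app k := by
  apply ((adjl x).homEquiv _ _).injective
  refine ((adjl x).homEquiv_naturality_left ((Hl.map f.op).app k) _).trans
    (Eq.trans ?_ (hnatl f _ _ _).symm)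
  have h (z : C) : (adjl z).homEquiv ((Hl.obj (op z)).obj k) k ((adjl z).counit.app k) = 𝟙 _ :=
    (Equiv.eq_symm_apply _).mp ((adjl z).homEquiv_symm_id k).symm
  simp [h]

/-- Dinaturality of the evaluation of the right internal hom. -/
lemma whiskerLeft_map_comp_counit (adjr : ∀ x : C, tensorLeft x ⊣ Hr.obj (op x))
    (hnatr : ∀ {x x' : C} (f : x' ⟶ x) (y z : C) (g : x ⊗ y ⟶ z),
      ((adjr x').homEquiv y z) ((f ▷ y) ≫ g) =
        ((adjr x).homEquiv y z) g ≫ (Hr.map f.op).app z)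
    {x y : C} (f : x ⟶ y) (k : C) :
    (x ◁ (Hr.map f.op).app k) ≫ (adjr x).counit.app k =
      (f ▷ (Hr.obj (op y)).obj k) ≫ (adjr y).counit.app k := by
  apply ((adjr x).homEquiv _ _).injective
  refine ((adjr x).homEquiv_naturality_left ((Hr.map f.op).app k) _).trans
    (Eq.trans ?_ (hnatr f _ _ _).symm)
  have h (z : C) : (adjr z).homEquiv ((Hr.obj (op z)).obj k) k ((adjr z).counit.app k) = 𝟙 _ :=
    (Equiv.eq_symm_apply _).mp ((adjr z).homEquiv_symm_id k).symm
  simp [h]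

/-- The bijection `Hom(x ⊗ y, Hl(z,k)) ≃ Hom(x, Hl(y ⊗ z, k))`. -/
def tensorHomEquiv (adjl : ∀ y : C, tensorRight y ⊣ Hl.obj (op y)) (k x y z : C) :
    (x ⊗ y ⟶ (Hl.obj (op z)).obj k) ≃ (x ⟶ (Hl.obj (op (y ⊗ z))).obj k) :=
  (((adjl z).homEquiv (x ⊗ y) k).symm.trans (α_ x y z).homFromEquiv).trans
    ((adjl (y ⊗ z)).homEquiv x k)

lemma tensorHomEquiv_homEquiv (adjl : ∀ y : C, tensorRight y ⊣ Hl.obj (op y)) (k x y z : C)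
    (g : (x ⊗ y) ⊗ z ⟶ k) :
    tensorHomEquiv adjl k x y z ((adjl z).homEquiv (x ⊗ y) k g) =
      (adjl (y ⊗ z)).homEquiv x k ((α_ x y z).inv ≫ g) := by
  simp [tensorHomEquiv]

end InternalHomDuality

/-- Implication (1) ⇒ (2) in the equivalence of definitions of a ★-autonomous category.
Let `C` be biclosed, with internal homs assembled into bifunctors
`Hl, Hr : Cᵒᵖ ⥤ C ⥤ C` together with adjunctions `(− ⊗ y) ⊣ Hl(y,−)` and
`(x ⊗ −) ⊣ Hr(x,−)` compatible with the first (contravariant) variable.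
For an object `k`, let `ev_{x,k} : Hl(x,k) ⊗ x ⟶ k` be the counit (the adjunct of the
identity), let `u_x : x ⟶ Hr(Hl(x,k),k)` be the adjunct of `ev_{x,k}`, and
`v_x : x ⟶ Hl(Hr(x,k),k)` the adjunct of the counit `x ⊗ Hr(x,k) ⟶ k`. If `k` is
dualizing (all `u_x`, `v_x` are isomorphisms), then `x ↦ Hl(x,k)` underlies an
equivalence `C ⥤ Cᵒᵖ` with quasi-inverse `x ↦ Hr(x,k)`, and there are bijections
`Hom(x ⊗ y, Hl(z,k)) ≅ Hom(x, Hl(y ⊗ z, k))` natural in `x, y, z`. -/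
theorem statement_5 {C : Type*} [Category C] [MonoidalCategory C]
    (Hl Hr : Cᵒᵖ ⥤ C ⥤ C)
    (adjl : ∀ y : C, tensorRight y ⊣ Hl.obj (op y))
    (adjr : ∀ x : C, tensorLeft x ⊣ Hr.obj (op x))
    (hnatl : ∀ {y y' : C} (f : y' ⟶ y) (x z : C) (g : x ⊗ y ⟶ z),
      ((adjl y').homEquiv x z) ((x ◁ f) ≫ g) =
        ((adjl y).homEquiv x z) g ≫ (Hl.map f.op).app z)
    (hnatr : ∀ {x x' : C} (f : x' ⟶ x) (y z : C) (g : x ⊗ y ⟶ z),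
      ((adjr x').homEquiv y z) ((f ▷ y) ≫ g) =
        ((adjr x).homEquiv y z) g ≫ (Hr.map f.op).app z)
    (k : C)
    (hu : ∀ x : C, IsIso
      (((adjr ((Hl.obj (op x)).obj k)).homEquiv x k) ((adjl x).counit.app k)))
    (hv : ∀ x : C, IsIso
      (((adjl ((Hr.obj (op x)).obj k)).homEquiv x k) ((adjr x).counit.app k))) :
    Nonempty (((Hl.flip.obj k).rightOp ⋙ Hr.flip.obj k) ≅ 𝟭 C) ∧
    Nonempty ((Hr.flip.obj k ⋙ (Hl.flip.obj k).rightOp) ≅ 𝟭 Cᵒᵖ) ∧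
    ∃ e : ∀ x y z : C,
        (x ⊗ y ⟶ (Hl.obj (op z)).obj k) ≃ (x ⟶ (Hl.obj (op (y ⊗ z))).obj k),
      (∀ {x x' : C} (f : x' ⟶ x) (y z : C) (g : x ⊗ y ⟶ (Hl.obj (op z)).obj k),
        e x' y z ((f ▷ y) ≫ g) = f ≫ e x y z g) ∧
      (∀ (x : C) {y y' : C} (f : y' ⟶ y) (z : C) (g : x ⊗ y ⟶ (Hl.obj (op z)).obj k),
        e x y' z ((x ◁ f) ≫ g) = e x y z g ≫ (Hl.map (f ▷ z).op).app k) ∧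
      (∀ (x y : C) {z z' : C} (f : z' ⟶ z) (g : x ⊗ y ⟶ (Hl.obj (op z)).obj k),
        e x y z' (g ≫ (Hl.map f.op).app k) = e x y z g ≫ (Hl.map (y ◁ f).op).app k) := by
  refine ⟨⟨(NatIso.ofComponents (fun x ↦ @asIso _ _ _ _ _ (hu x)) ?_).symm⟩,
    ⟨NatIso.ofComponents (fun x ↦ (@asIso _ _ _ _ _ (hv x.unop)).op) ?_⟩,
    tensorHomEquiv adjl k, ?_, ?_, ?_⟩
  · intro x y f
    refine ((adjr _).homEquiv_naturality_left f _).symm.trans (Eq.trans ?_ (hnatr _ _ _ _))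
    exact congrArg _ (whiskerRight_map_comp_counit adjl hnatl f k).symm
  · intro x y f
    apply Quiver.Hom.unop_inj
    refine Eq.symm (((adjl _).homEquiv_naturality_left f.unop _).symm.trans
      (Eq.trans ?_ (hnatl _ _ _ _)))
    exact congrArg _ (whiskerLeft_map_comp_counit adjr hnatr f.unop k).symm
  · intro x x' f y z g
    obtain ⟨g, rfl⟩ := ((adjl z).homEquiv (x ⊗ y) k).surjective g
    rw [← Adjunction.homEquiv_naturality_left, tensorHomEquiv_homEquiv, tensorHomEquiv_homEquiv,
      ← Adjunction.homEquiv_naturality_left]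
    simp
  · intro x y y' f z g
    obtain ⟨g, rfl⟩ := ((adjl z).homEquiv (x ⊗ y) k).surjective g
    rw [← Adjunction.homEquiv_naturality_left, tensorHomEquiv_homEquiv, tensorHomEquiv_homEquiv,
      ← hnatl]
    simp
  · intro x y z z' f g
    obtain ⟨g, rfl⟩ := ((adjl z).homEquiv (x ⊗ y) k).surjective g
    rw [← hnatl, tensorHomEquiv_homEquiv, tensorHomEquiv_homEquiv, ← hnatl]
    simp
end

section
/- Let k be a field in which every element of kˣ is a square (for instance, k algebraically closed), let G be a finite abelian group, and let q : G → kˣ be a weak quadratic form. Then there exist a character η : G → kˣ and a quadratic form q̃ : G → kˣ (i.e. a weak quadratic form satisfying q̃(g) = q̃(g⁻¹) for all g) such that q(g) = q̃(g)·η(g) for all g ∈ G. Moreover, the associated bihomomorphisms coincide: β_q = β_{q̃}. -/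
/-- The map `β_q` associated to a map `q : G → kˣ`,
`β_q(a,b) = q(ab)·q(a)⁻¹·q(b)⁻¹`. -/
def betaMul {k : Type*} [Field k] {G : Type*} [Group G] (q : G → kˣ) (a b : G) : kˣ :=
  q (a * b) * (q a)⁻¹ * (q b)⁻¹

/-- `q` is a weak quadratic form iff `β_q` is a bihomomorphism. -/
def IsWeakQuadraticForm {k : Type*} [Field k] {G : Type*} [Group G] (q : G → kˣ) : Prop :=
  (∀ a b c : G, betaMul q (a * b) c = betaMul q a c * betaMul q b c) ∧
  (∀ a b c : G, betaMul q a (b * c) = betaMul q a b * betaMul q a c)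

/-- A homomorphism into a 2-divisible group extends from a subgroup containing all doubles. -/
theorem exists_extension_of_two_divisible {A D : Type*} [AddCommGroup A] [AddCommGroup D]
    [WellFoundedGT (Submodule ℤ A)] (hD : ∀ d : D, ∃ e : D, (2 : ℤ) • e = d)
    (f : A →ₗ.[ℤ] D) (hf : ∀ a : A, (2 : ℤ) • a ∈ f.domain) :
    ∃ F : A →ₗ[ℤ] D, ∀ x : f.domain, F x = f x := by
  suffices H : ∀ S : Submodule ℤ A, ∀ f : A →ₗ.[ℤ] D, f.domain = S →
      (∀ a : A, (2 : ℤ) • a ∈ f.domain) → ∃ F : A →ₗ[ℤ] D, ∀ x : f.domain, F x = f x from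
    H _ f rfl hf
  intro S
  induction S using WellFoundedGT.induction with
  | ind S ih =>
    rintro f rfl hf
    by_cases htop : f.domain = ⊤
    · exact ⟨f.toFun ∘ₗ LinearMap.id.codRestrict f.domain (fun x => by simp [htop]),
        fun x => rfl⟩
    obtain ⟨a, ha⟩ : ∃ a, a ∉ f.domain := by
      by_contra! h
      exact htop (eq_top_iff.2 fun x _ => h x)
    obtain ⟨v, hv⟩ := hD (f ⟨(2 : ℤ) • a, hf a⟩)
    have key : ∀ (c : ℤ) (x : f.domain), (x : A) = c • a → f x = c • v := by
      intro c x hx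
      rcases Int.even_or_odd' c with ⟨d, rfl | rfl⟩
      · have : x = d • ⟨(2 : ℤ) • a, hf a⟩ := by
          apply Subtype.ext
          change (x : A) = d • ((2 : ℤ) • a)
          rw [hx, smul_smul, mul_comm]
        rw [this, f.map_smul, ← hv, smul_smul, mul_comm]
      · refine absurd ?_ ha
        have h : a = (x : A) - d • ((2 : ℤ) • a) := by
          rw [hx]
          module
        rw [h]
        exact f.domain.sub_mem x.2 (f.domain.smul_mem d (hf a))
    let g : A →ₗ.[ℤ] D := LinearPMap.mkSpanSingleton' a v fun c hc => by
      exact (key c 0 (by simp [hc])).symm.trans f.map_zero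
    have hag : a ∈ g.domain := Submodule.mem_span_singleton_self a
    have hfg : ∀ (x : f.domain) (y : g.domain), (x : A) = y → f x = g y := by
      rintro x ⟨y, hy⟩ hxy
      obtain ⟨c, rfl⟩ := Submodule.mem_span_singleton.1 hy
      exact (key c x hxy).trans (LinearPMap.mkSpanSingleton'_apply a v _ c hy).symm
    have hle : f ≤ f.sup g hfg := LinearPMap.left_le_sup f g hfg
    have hlt : f.domain < (f.sup g hfg).domain :=
      lt_of_le_of_ne hle.1 fun h => ha
        (h ▸ (LinearPMap.right_le_sup f g hfg).1 hag)
    obtain ⟨F, hF⟩ := ih _ hlt (f.sup g hfg) rfl fun b => hle.1 (hf b)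
    exact ⟨F, fun x => (hF ⟨x, hle.1 x.2⟩).trans (hle.2 rfl).symm⟩

/-- A character with 2-divisible target that is trivial on 2-torsion has a square root. -/
theorem exists_sq_eq_of_two_torsion {G M : Type*} [CommGroup G] [Finite G] [CommGroup M]
    (hM : ∀ u : M, ∃ v : M, v ^ 2 = u) (χ : G →* M) (hχ : ∀ g : G, g ^ 2 = 1 → χ g = 1) :
    ∃ η : G →* M, ∀ g, η g ^ 2 = χ g := by
  let s : Additive G →ₗ[ℤ] Additive G := (2 : ℤ) • LinearMap.id
  let c : Additive G →ₗ[ℤ] Additive M := χ.toAdditive.toIntLinearMap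
  have hker : s.ker ≤ c.ker := fun x hx => hχ x.toMul (by
    have : (2 : ℤ) • x = 0 := hx
    exact_mod_cast congrArg Additive.toMul this)
  let f : Additive G →ₗ.[ℤ] Additive M :=
    ⟨s.range, s.ker.liftQ c hker ∘ₗ s.quotKerEquivRange.symm.toLinearMap⟩
  have hfs : ∀ x (hx : s x ∈ f.domain), f ⟨s x, hx⟩ = c x := fun x hx => by
    change s.ker.liftQ c hker (s.quotKerEquivRange.symm ⟨s x, hx⟩) = c x
    rw [LinearMap.quotKerEquivRange_symm_apply_image]
    simp
  obtain ⟨F, hF⟩ := exists_extension_of_two_divisible (fun d => by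
    obtain ⟨v, hv⟩ := hM d.toMul
    exact ⟨Additive.ofMul v, by exact_mod_cast congrArg Additive.ofMul hv⟩) f
    fun a => ⟨a, rfl⟩
  refine ⟨AddMonoidHom.toMultiplicative F.toAddMonoidHom, fun g => ?_⟩
  have h : (2 : ℤ) • F (Additive.ofMul g) = c (Additive.ofMul g) := by
    rw [← hfs _ ⟨_, rfl⟩, ← hF, ← F.map_smul]
    rfl
  exact_mod_cast congrArg Additive.toMul h

theorem apply_mul_eq_betaMul {k : Type*} [Field k] {G : Type*} [Group G] (q : G → kˣ) (a b : G) :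
    q (a * b) = betaMul q a b * q a * q b := by
  rw [betaMul, mul_right_comm, inv_mul_cancel_right, inv_mul_cancel_right]

theorem IsWeakQuadraticForm.betaMul_inv_inv {k : Type*} [Field k] {G : Type*} [Group G]
    {q : G → kˣ} (hq : IsWeakQuadraticForm q) (a b : G) :
    betaMul q a⁻¹ b⁻¹ = betaMul q a b := by
  have h₁ : ∀ a b, betaMul q a⁻¹ b = (betaMul q a b)⁻¹ := fun a b =>
    map_inv (MonoidHom.mk' (fun x => betaMul q x b) fun x y => hq.1 x y b) a
  have h₂ : ∀ a b, betaMul q a b⁻¹ = (betaMul q a b)⁻¹ := fun a b =>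
    map_inv (MonoidHom.mk' (fun x => betaMul q a x) fun x y => hq.2 a x y) b
  rw [h₁, h₂, inv_inv]

/-- If every unit of `k` is a square and `G` is a finite abelian group, then every weak
quadratic form `q : G → kˣ` decomposes as `q = q̃ · η` with `q̃` a quadratic form
(a weak quadratic form with `q̃(g) = q̃(g⁻¹)`) and `η` a character; moreover
`β_q = β_{q̃}`. -/
theorem statement_8 {k : Type*} [Field k] (hsq : ∀ u : kˣ, ∃ v : kˣ, v ^ 2 = u)
    {G : Type*} [CommGroup G] [Finite G]
    (q : G → kˣ) (hq : IsWeakQuadraticForm q) :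
    ∃ (η : G →* kˣ) (qt : G → kˣ),
      IsWeakQuadraticForm qt ∧ (∀ g : G, qt g = qt g⁻¹) ∧
      (∀ g : G, q g = qt g * η g) ∧
      (∀ a b : G, betaMul q a b = betaMul qt a b) := by
  let χ : G →* kˣ := MonoidHom.mk' (fun g => q g / q g⁻¹) fun a b => by
    rw [mul_inv, apply_mul_eq_betaMul q a b, apply_mul_eq_betaMul q a⁻¹ b⁻¹, hq.betaMul_inv_inv,
      mul_assoc, mul_assoc, mul_div_mul_left_eq_div, mul_div_mul_comm]
  obtain ⟨η, hη⟩ := exists_sq_eq_of_two_torsion hsq χ fun g hg => by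
    have : g⁻¹ = g := inv_eq_of_mul_eq_one_left (by rw [← sq, hg])
    change q g / q g⁻¹ = 1
    rw [this, div_self']
  have hβ : betaMul (fun g => q g / η g) = betaMul q := by
    funext a b
    simp only [betaMul, map_mul, div_eq_mul_inv, mul_inv, inv_inv]
    calc _ = q (a * b) * (q a)⁻¹ * (q b)⁻¹ * (η a * (η a)⁻¹) * (η b * (η b)⁻¹) := by ac_rfl
      _ = _ := by simp
  refine ⟨η, fun g => q g / η g, ?_, fun g => ?_, fun g => by simp, fun a b => by rw [hβ]⟩
  · rwa [IsWeakQuadraticForm, hβ]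
  · have h : η g ^ 2 = q g / q g⁻¹ := hη g
    change q g / η g = q g⁻¹ / η g⁻¹
    rw [map_inv, div_inv_eq_mul, div_eq_iff_eq_mul, mul_assoc, ← sq, h, mul_div_cancel]
end

section
/- Let k be a field, G a finite abelian group, q̃ : G → kˣ a quadratic form, η : G → kˣ a character, and set q := q̃·η (pointwise product), which is a weak quadratic form. Suppose there exists g₀ ∈ G such that η(g) = β_q(g,g₀) for all g ∈ G. Then q(g) = q̃(g·g₀)·q̃(g₀)⁻¹ for all g ∈ G, and, in particular, q is symmetric with respect to g̃₀ := g₀⁻², i.e. q(g) = q(g̃₀·g⁻¹) for all g ∈ G. -/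
/-- Let `q̃` be a quadratic form on a finite abelian group `G`, `η` a character,
and `q := q̃·η`. If there is `g₀ ∈ G` with `η(g) = β_q(g,g₀)` for all `g`, then
`q(g) = q̃(g·g₀)·q̃(g₀)⁻¹` for all `g`; in particular `q` is symmetric with respect to
`g̃₀ := g₀⁻²`, i.e. `q(g) = q(g̃₀·g⁻¹)`. -/
theorem statement_10 {k : Type*} [Field k] {G : Type*} [CommGroup G] [Finite G]
    (qt : G → kˣ) (hqt : IsWeakQuadraticForm qt) (hsymm : ∀ g : G, qt g = qt g⁻¹)
    (η : G →* kˣ) (q : G → kˣ) (hqdef : ∀ g : G, q g = qt g * η g)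
    (g₀ : G) (hη : ∀ g : G, η g = betaMul q g g₀) :
    (∀ g : G, q g = qt (g * g₀) * (qt g₀)⁻¹) ∧
    (∀ g : G, q g = q (g₀⁻¹ * g₀⁻¹ * g⁻¹)) := by
  have hq : ∀ g : G, q g = qt (g * g₀) * (qt g₀)⁻¹ := by
    intro g
    have hη' : η g = qt (g * g₀) * (qt g)⁻¹ * (qt g₀)⁻¹ := by
      rw [hη, betaMul, hqdef, hqdef, hqdef, map_mul, mul_inv, mul_inv]
      calc _ = qt (g * g₀) * (qt g)⁻¹ * (qt g₀)⁻¹ *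
              (η g * (η g)⁻¹) * (η g₀ * (η g₀)⁻¹) := by ac_rfl
        _ = _ := by simp
    rw [hqdef, hη']
    calc _ = qt (g * g₀) * (qt g₀)⁻¹ * (qt g * (qt g)⁻¹) := by ac_rfl
      _ = _ := by simp
  refine ⟨hq, fun g => ?_⟩
  have hg : g₀⁻¹ * g₀⁻¹ * g⁻¹ * g₀ = (g * g₀)⁻¹ := by
    rw [mul_inv]
    calc _ = g⁻¹ * g₀⁻¹ * (g₀⁻¹ * g₀) := by ac_rfl
      _ = _ := by simp
  rw [hq, hq, hg, ← hsymm]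
end

section
/- Let k be a field, G a finite abelian group, g₀ ∈ G, and let q : G → kˣ be a weak quadratic form that is symmetric with respect to g₀, i.e. q(g) = q(g⁻¹g₀) for all g ∈ G. Then for every g ∈ G and every natural number m: q(g^m) = q(g)^(m² − m(m−1)/2) · q(g·g₀)^(m(m−1)/2) and q(g^(−m)) = q(g)^(m(m−1)/2) · q(g·g₀)^(m² − m(m−1)/2), where m(m−1)/2 is the sum of all natural numbers strictly less than m. -/
theorem Nat.sq_sub_choose_two (m : ℕ) : m ^ 2 - m.choose 2 = m + m.choose 2 := by
  have h_sq : m ^ 2 = m + 2 * m.choose 2 := by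
    induction m with
    | zero => rfl
    | succ m ih =>
      rw [Nat.choose_succ_succ' m 1, Nat.choose_one_right]
      linarith
  omega

/-- A weak quadratic form takes the value `1` at the identity. -/
theorem IsWeakQuadraticForm.map_one {k : Type*} [Field k] {G : Type*} [Group G] {q : G → kˣ}
    (hq : IsWeakQuadraticForm q) : q 1 = 1 := by
  simpa [betaMul] using hq.1 1 1 1

/-- For a weak quadratic form, `β_q(g,g) = q(g)·q(g⁻¹)`. -/
theorem IsWeakQuadraticForm.betaMul_self {k : Type*} [Field k] {G : Type*} [Group G] {q : G → kˣ}
    (hq : IsWeakQuadraticForm q) (g : G) : betaMul q g g = q g * q g⁻¹ := by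
  have h := hq.2 g g g⁻¹
  have h_one : betaMul q g 1 = 1 := by simp [betaMul, hq.map_one]
  have h_inv : betaMul q g g⁻¹ = (q g * q g⁻¹)⁻¹ := by
    simp [betaMul, hq.map_one, mul_comm]
  rw [mul_inv_cancel, h_one, h_inv] at h
  exact (mul_inv_eq_one.mp h.symm)

/-- The bihomomorphism of a weak quadratic form on powers of its first argument. -/
theorem IsWeakQuadraticForm.betaMul_pow_left {k : Type*} [Field k] {G : Type*} [Group G]
    {q : G → kˣ} (hq : IsWeakQuadraticForm q) (a b : G) (m : ℕ) :
    betaMul q (a ^ m) b = betaMul q a b ^ m := by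
  induction m with
  | zero => simp [betaMul, hq.map_one]
  | succ m ih => rw [pow_succ, hq.1, ih, pow_succ]

/-- The values of a weak quadratic form on powers. -/
theorem IsWeakQuadraticForm.map_pow {k : Type*} [Field k] {G : Type*} [Group G] {q : G → kˣ}
    (hq : IsWeakQuadraticForm q) (g : G) (m : ℕ) :
    q (g ^ m) = q g ^ (m ^ 2 - m.choose 2) * q g⁻¹ ^ m.choose 2 := by
  rw [Nat.sq_sub_choose_two, pow_add, mul_assoc, ← mul_pow, ← hq.betaMul_self]
  induction m with
  | zero => simp [hq.map_one]
  | succ m ih =>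
    have h_mul : q (g ^ (m + 1)) = betaMul q (g ^ m) g * q (g ^ m) * q g := by
      rw [betaMul, pow_succ, mul_right_comm, inv_mul_cancel_right, inv_mul_cancel_right]
    rw [h_mul, hq.betaMul_pow_left, ih, Nat.choose_succ_succ' m 1, Nat.choose_one_right,
      pow_succ (q g), pow_add (betaMul q g g)]
    simp only [mul_assoc, mul_comm, mul_left_comm]

/-- If `q` is a weak quadratic form on a finite abelian group `G` symmetric with respect
to `g₀` (i.e. `q(g) = q(g⁻¹g₀)`), then for every `g` and every natural number `m`:
`q(g^m) = q(g)^(m² − C(m,2)) · q(g·g₀)^(C(m,2))` and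
`q(g^(−m)) = q(g)^(C(m,2)) · q(g·g₀)^(m² − C(m,2))`,
where `C(m,2) = m(m−1)/2` is the sum of all naturals strictly less than `m`. -/
theorem statement_11 {k : Type*} [Field k] {G : Type*} [CommGroup G] [Finite G]
    (q : G → kˣ) (hq : IsWeakQuadraticForm q)
    (g₀ : G) (hsymm : ∀ g : G, q g = q (g⁻¹ * g₀))
    (g : G) (m : ℕ) :
    q (g ^ m) = q g ^ (m ^ 2 - m.choose 2) * q (g * g₀) ^ m.choose 2 ∧
    q (g ^ (-(m : ℤ))) = q g ^ m.choose 2 * q (g * g₀) ^ (m ^ 2 - m.choose 2) := by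
  have h_inv : q (g * g₀) = q g⁻¹ := by
    rw [hsymm (g * g₀), mul_inv, inv_mul_cancel_right]
  rw [h_inv]
  refine ⟨hq.map_pow g m, ?_⟩
  rw [zpow_neg, zpow_natCast, ← inv_pow, hq.map_pow, inv_inv, mul_comm]
end

section
/- Let k be a field, G a finite abelian group, and let q : G → kˣ be a weak quadratic form. Then the following two conditions are equivalent: (i) q(g) = q(g⁻¹) for all g ∈ G; (ii) q(g^m) = q(g)^(m²) for all g ∈ G and all natural numbers m. (This establishes the equivalence of the two common definitions of a quadratic form on a finite abelian group.) -/
namespace IsWeakQuadraticForm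

variable {k : Type*} [Field k] {G : Type*} [Group G] {q : G → kˣ}

theorem map_mul (q : G → kˣ) (a b : G) : q (a * b) = betaMul q a b * q b * q a := by
  simp [betaMul]

theorem map_one_s12 (hq : IsWeakQuadraticForm q) : q 1 = 1 := by
  simpa [betaMul] using hq.1 1 1 1

theorem betaMul_one_left (hq : IsWeakQuadraticForm q) (a : G) : betaMul q 1 a = 1 := by
  simp [betaMul, hq.map_one_s12]

theorem betaMul_one_right (hq : IsWeakQuadraticForm q) (a : G) : betaMul q a 1 = 1 := by
  simp [betaMul, hq.map_one_s12]

theorem betaMul_pow_left_s12 (hq : IsWeakQuadraticForm q) (a b : G) (m : ℕ) :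
    betaMul q (a ^ m) b = betaMul q a b ^ m := by
  induction m with
  | zero => simp [hq.betaMul_one_left]
  | succ m ih => rw [pow_succ, hq.1, ih, pow_succ]

theorem betaMul_self_s12 (hq : IsWeakQuadraticForm q) (g : G) :
    betaMul q g g = q g * q g⁻¹ := by
  have h := hq.2 g g g⁻¹
  rw [mul_inv_cancel, hq.betaMul_one_right] at h
  rw [eq_inv_of_mul_eq_one_left h.symm]
  simp [betaMul, hq.map_one_s12, mul_comm]

theorem map_pow_s12 (hq : IsWeakQuadraticForm q) (hinv : ∀ g, q g = q g⁻¹) (g : G) (m : ℕ) :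
    q (g ^ m) = q g ^ (m ^ 2) := by
  induction m with
  | zero => simp [hq.map_one_s12]
  | succ m ih =>
    rw [pow_succ, map_mul q, hq.betaMul_pow_left_s12, hq.betaMul_self_s12, ← hinv, ih]
    ext
    push_cast
    ring

theorem map_inv (hq : IsWeakQuadraticForm q) {g : G} (hsq : q (g ^ 2) = q g ^ 4) :
    q g = q g⁻¹ := by
  have h : q g ^ 3 * q g = q g ^ 3 * q g⁻¹ := by
    rw [← pow_succ, ← hsq, sq, map_mul q, hq.betaMul_self_s12]
    ext
    push_cast
    ring
  exact mul_left_cancel h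

end IsWeakQuadraticForm

/-- For a weak quadratic form `q` on a finite abelian group `G`, the condition
`q(g) = q(g⁻¹)` for all `g` is equivalent to `q(g^m) = q(g)^(m²)` for all `g` and
all natural numbers `m`. -/
theorem statement_12 {k : Type*} [Field k] {G : Type*} [CommGroup G] [Finite G]
    (q : G → kˣ) (hq : IsWeakQuadraticForm q) :
    (∀ g : G, q g = q g⁻¹) ↔ (∀ (g : G) (m : ℕ), q (g ^ m) = q g ^ (m ^ 2)) := by
  exact ⟨hq.map_pow_s12, fun h g => hq.map_inv (h g 2)⟩
end

section
/- Let k be a field, G a finite abelian group, g₀, g₁ ∈ G, and let q₀, q₁ : G → kˣ be weak quadratic forms with q₀(g) = q₀(g⁻¹g₀) and q₁(g) = q₁(g⁻¹g₁) for all g ∈ G. If β_{q₀} = β_{q₁}, then the pointwise quotient η := q₀·q₁⁻¹ is a character (group homomorphism G → kˣ), so q₀ = q₁·η; moreover, if g₀ = g₁ = 1 then η takes values in {±1}, i.e. η(g)² = 1 for all g. Conversely, if q₀ = q₁·η for some character η, then β_{q₀} = β_{q₁}. -/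
/-- Let `q₀, q₁` be weak quadratic forms on a finite abelian group `G`, symmetric with
respect to `g₀` resp. `g₁`. If `β_{q₀} = β_{q₁}` then the pointwise quotient
`η := q₀·q₁⁻¹` is a character with `q₀ = q₁·η`; moreover if `g₀ = g₁ = 1` then
`η` takes values in `{±1}`. Conversely, if `q₀ = q₁·η` for some character `η`, then
`β_{q₀} = β_{q₁}`. -/
theorem statement_13 {k : Type*} [Field k] {G : Type*} [CommGroup G] [Finite G]
    (q₀ q₁ : G → kˣ) (h₀ : IsWeakQuadraticForm q₀) (h₁ : IsWeakQuadraticForm q₁)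
    (g₀ g₁ : G) (hs₀ : ∀ g : G, q₀ g = q₀ (g⁻¹ * g₀)) (hs₁ : ∀ g : G, q₁ g = q₁ (g⁻¹ * g₁)) :
    ((∀ a b : G, betaMul q₀ a b = betaMul q₁ a b) →
      ∃ η : G →* kˣ, (∀ g : G, η g = q₀ g * (q₁ g)⁻¹) ∧
        (∀ g : G, q₀ g = q₁ g * η g) ∧
        (g₀ = 1 → g₁ = 1 → ∀ g : G, η g ^ 2 = 1)) ∧
    ((∃ η : G →* kˣ, ∀ g : G, q₀ g = q₁ g * η g) →
      ∀ a b : G, betaMul q₀ a b = betaMul q₁ a b) := by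
  refine ⟨fun h => ?_, ?_⟩
  · have hmul (a b : G) : q₀ (a * b) * (q₁ (a * b))⁻¹ =
        q₀ a * (q₁ a)⁻¹ * (q₀ b * (q₁ b)⁻¹) := by
      have hab := h a b
      simp only [betaMul, ← div_eq_mul_inv, div_div, div_eq_div_iff_mul_eq_mul] at hab
      rw [← div_eq_mul_inv, ← div_eq_mul_inv, ← div_eq_mul_inv, div_mul_div_comm,
        div_eq_div_iff_mul_eq_mul, hab, mul_comm]
    let η : G →* kˣ := MonoidHom.mk' (fun g => q₀ g * (q₁ g)⁻¹) hmul
    have hη (g : G) : η g = q₀ g * (q₁ g)⁻¹ := rfl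
    refine ⟨η, hη, fun g => ?_, ?_⟩
    · rw [hη, mul_comm, inv_mul_cancel_right]
    · rintro rfl rfl g
      have hinv : η g⁻¹ = η g := by
        rw [hη, hη, hs₀ g, hs₁ g, mul_one]
      rw [sq]
      nth_rewrite 1 [← hinv]
      rw [← map_mul, inv_mul_cancel, map_one]
  · rintro ⟨η, hη⟩ a b
    simp only [betaMul, hη, map_mul, ← div_eq_mul_inv, div_div, div_eq_div_iff_mul_eq_mul]
    ac_rfl
end

section
/- Let k be a field and G a finite abelian group, and let (ψ, Ω) be a normalized abelian 3-cocycle on G with values in kˣ: ψ : G³ → kˣ and Ω : G² → kˣ are normalized (equal to 1 whenever an argument is the identity), ψ satisfies the 3-cocycle identity ψ(g₂,g₃,g₄)·ψ(g₁g₂,g₃,g₄)⁻¹·ψ(g₁,g₂g₃,g₄)·ψ(g₁,g₂,g₃g₄)⁻¹·ψ(g₁,g₂,g₃) = 1, and the pair satisfies the two hexagon identities ψ(g₂,g₃,g₁)⁻¹·Ω(g₁,g₂g₃)·ψ(g₁,g₂,g₃)⁻¹ = Ω(g₁,g₃)·ψ(g₂,g₁,g₃)⁻¹·Ω(g₁,g₂)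 and ψ(g₃,g₁,g₂)·Ω(g₁g₂,g₃)·ψ(g₁,g₂,g₃) = Ω(g₁,g₃)·ψ(g₁,g₃,g₂)·Ω(g₂,g₃) for all g₁,g₂,g₃,g₄ ∈ G. Then the map q_Ω : G → kˣ defined by q_Ω(g) := Ω(g,g) is a quadratic form, i.e. q_Ω(g) = q_Ω(g⁻¹) for all g and β_{q_Ω} is a bihomomorphism; moreover the associated bihomomorphism satisfies β_{q_Ω}(g₁,g₂) = Ω(g₁,g₂)·Ω(g₂,g₁) for all g₁, g₂ ∈ G. -/
/-- The hexagon identities alone make `(a, b) ↦ Ω a b + Ω b a` additive in the first variable. -/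
theorem symmetrization_mul_left_of_hexagon {A G : Type*} [AddCommGroup A] [CommGroup G]
    (ψ : G → G → G → A) (Ω : G → G → A)
    (hhex₁ : ∀ a b c : G, -ψ b c a + Ω a (b * c) + -ψ a b c = Ω a c + -ψ b a c + Ω a b)
    (hhex₂ : ∀ a b c : G, ψ c a b + Ω (a * b) c + ψ a b c = Ω a c + ψ a c b + Ω b c)
    (a b c : G) :
    Ω (a * b) c + Ω c (a * b) = (Ω a c + Ω c a) + (Ω b c + Ω c b) := by
  have h₁ := hhex₁ c a b
  have h₂ := hhex₂ a b c
  grind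

/-- The diagonal of the braiding of an abelian 3-cocycle has polarization `Ω a b + Ω b a`. -/
theorem diagonal_mul_of_abelian_cocycle {A G : Type*} [AddCommGroup A] [CommGroup G]
    (ψ : G → G → G → A) (Ω : G → G → A)
    (hcocycle : ∀ a b c d : G,
      ψ b c d + -ψ (a * b) c d + ψ a (b * c) d + -ψ a b (c * d) + ψ a b c = 0)
    (hhex₁ : ∀ a b c : G, -ψ b c a + Ω a (b * c) + -ψ a b c = Ω a c + -ψ b a c + Ω a b)
    (hhex₂ : ∀ a b c : G, ψ c a b + Ω (a * b) c + ψ a b c = Ω a c + ψ a c b + Ω b c)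
    (a b : G) :
    Ω (a * b) (a * b) + -Ω a a + -Ω b b = Ω a b + Ω b a := by
  have h₁ := hhex₁ (a * b) a b
  have h₂ := hhex₂ a b a
  have h₃ := hhex₂ a b b
  have h₄ := hcocycle a b a b
  rw [mul_comm b a] at h₄
  grind

/-- For a normalized abelian 3-cocycle `(ψ, Ω)` on a finite abelian group `G` with values
in `kˣ`, the map `q_Ω(g) := Ω(g,g)` is a quadratic form (a weak quadratic form with
`q_Ω(g) = q_Ω(g⁻¹)`), and `β_{q_Ω}(g₁,g₂) = Ω(g₁,g₂)·Ω(g₂,g₁)`. -/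
theorem statement_18 {k : Type*} [Field k] {G : Type*} [CommGroup G] [Finite G]
    (ψ : G → G → G → kˣ) (Ω : G → G → kˣ)
    (hψnorm : ∀ a b : G, ψ 1 a b = 1 ∧ ψ a 1 b = 1 ∧ ψ a b 1 = 1)
    (hΩnorm : ∀ a : G, Ω 1 a = 1 ∧ Ω a 1 = 1)
    (hcocycle : ∀ g₁ g₂ g₃ g₄ : G,
      ψ g₂ g₃ g₄ * (ψ (g₁ * g₂) g₃ g₄)⁻¹ * ψ g₁ (g₂ * g₃) g₄ *
        (ψ g₁ g₂ (g₃ * g₄))⁻¹ * ψ g₁ g₂ g₃ = 1)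
    (hhex₁ : ∀ g₁ g₂ g₃ : G,
      (ψ g₂ g₃ g₁)⁻¹ * Ω g₁ (g₂ * g₃) * (ψ g₁ g₂ g₃)⁻¹ =
        Ω g₁ g₃ * (ψ g₂ g₁ g₃)⁻¹ * Ω g₁ g₂)
    (hhex₂ : ∀ g₁ g₂ g₃ : G,
      ψ g₃ g₁ g₂ * Ω (g₁ * g₂) g₃ * ψ g₁ g₂ g₃ =
        Ω g₁ g₃ * ψ g₁ g₃ g₂ * Ω g₂ g₃) :
    IsWeakQuadraticForm (fun g : G => Ω g g) ∧
    (∀ g : G, Ω g g = Ω g⁻¹ g⁻¹) ∧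
    (∀ g₁ g₂ : G, betaMul (fun g : G => Ω g g) g₁ g₂ = Ω g₁ g₂ * Ω g₂ g₁) := by
  have hβ : ∀ a b : G, betaMul (fun g : G => Ω g g) a b = Ω a b * Ω b a :=
    diagonal_mul_of_abelian_cocycle (A := Additive kˣ) ψ Ω hcocycle hhex₁ hhex₂
  have hleft : ∀ a b c : G,
      Ω (a * b) c * Ω c (a * b) = (Ω a c * Ω c a) * (Ω b c * Ω c b) :=
    symmetrization_mul_left_of_hexagon (A := Additive kˣ) ψ Ω hhex₁ hhex₂
  refine ⟨⟨fun a b c => ?_, fun a b c => ?_⟩, fun g => ?_, hβ⟩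
  · simp only [hβ, hleft]
  · simp only [hβ]
    rw [mul_comm (Ω a (b * c)), hleft, mul_comm (Ω b a), mul_comm (Ω c a)]
  · have h₁ := hβ g g⁻¹
    have h₂ := hleft g g⁻¹ g
    simp only [betaMul, mul_inv_cancel, (hΩnorm _).1, (hΩnorm _).2, one_mul] at h₁ h₂
    rw [mul_comm (Ω g⁻¹ g), ← h₁] at h₂
    calc Ω g g = Ω g g * Ω g g * ((Ω g g)⁻¹ * (Ω g⁻¹ g⁻¹)⁻¹) * Ω g⁻¹ g⁻¹ := by
          simp [mul_assoc]
      _ = Ω g⁻¹ g⁻¹ := by rw [← h₂, one_mul]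
end
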